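/- The number of short roots equals the Coxeter number times the number of short simple roots: #Δ_s = h · #Π_s. -/

import Mathlib

open scoped RealInnerProductSpace

/-- The orthogonal reflection of a Euclidean space in the hyperplane orthogonal to `α`
(for `α ≠ 0` this is the usual reflection `x ↦ x - 2(x|α)/(α|α) α`). -/
noncomputable def rrefl {E : Type} [NormedAddCommGroup E] [InnerProductSpace ℝ E]
    [FiniteDimensional ℝ E] (α : E) : E ≃ₗᵢ[ℝ] E :=
  Submodule.reflection ((ℝ ∙ α)ᗮ)

/-- The group generated by the reflections `r_α` for `α ∈ S`. -/
noncomputable def weylOf {E : Type} [NormedAddCommGroup E] [InnerProductSpace ℝ E]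
    [FiniteDimensional ℝ E] (S : Set E) : Subgroup (E ≃ₗᵢ[ℝ] E) :=
  Subgroup.closure (rrefl '' S)

section aux
open Finset
variable {E : Type} [NormedAddCommGroup E] [InnerProductSpace ℝ E] [FiniteDimensional ℝ E]

lemma liMul (f g : E ≃ₗᵢ[ℝ] E) (x : E) : (f * g) x = f (g x) := rfl

lemma rrefl_eq (α z : E) : rrefl α z = z - (2 * ⟪α, z⟫ / ⟪α, α⟫) • α := by
  unfold rrefl
  rw [Submodule.reflection_orthogonal_apply, Submodule.reflection_singleton_apply]
  rw [real_inner_self_eq_norm_sq]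
  simp only [RCLike.ofReal_real_eq_id, id]
  rw [two_smul, ← add_smul, neg_sub]
  congr 2
  ring

lemma rrefl_self {α : E} (h : α ≠ 0) : rrefl α α = -α := by
  rw [rrefl_eq]
  have : ⟪α, α⟫ ≠ 0 := by simpa using h
  rw [mul_div_assoc, div_self this]
  module

lemma rrefl_invol (α z : E) : rrefl α (rrefl α z) = z := by
  unfold rrefl; simp

lemma rrefl_mul_self (α : E) : rrefl α * rrefl α = 1 := by
  ext z; simp [rrefl_invol]

lemma rrefl_conj (g : E ≃ₗᵢ[ℝ] E) (α : E) : g * rrefl α = rrefl (g α) * g := by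
  ext z; simp [rrefl_eq]

lemma rrefl_comm {α β : E} (h : ⟪α, β⟫ = 0) : rrefl α * rrefl β = rrefl β * rrefl α := by
  rw [rrefl_conj]
  congr 2
  rw [rrefl_eq, h]; simp

/-- working package for a based root system -/
structure RS (Δ : Set E) (F : Finset E) (co : E → E →ₗ[ℝ] ℝ) : Prop where
  fin : Δ.Finite
  zero : (0 : E) ∉ Δ
  refl : ∀ α ∈ Δ, ∀ β ∈ Δ, rrefl α β ∈ Δ
  crys : ∀ α ∈ Δ, ∀ β ∈ Δ, ∃ n : ℤ, 2 * ⟪β, α⟫ / ⟪α, α⟫ = (n : ℝ)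
  red : ∀ α ∈ Δ, ∀ t : ℝ, t • α ∈ Δ → t = 1 ∨ t = -1
  irr : ∀ A B : Set E, A ∪ B = Δ → (∀ a ∈ A, ∀ b ∈ B, ⟪a, b⟫ = 0) → A = ∅ ∨ B = ∅
  sub : ∀ α ∈ F, α ∈ Δ
  dec : ∀ z, ∑ β ∈ F, co β z • β = z
  same : ∀ α ∈ F, co α α = 1
  diff : ∀ α ∈ F, ∀ β ∈ F, β ≠ α → co β α = 0
  sign : ∀ γ ∈ Δ, (∀ β ∈ F, 0 ≤ co β γ) ∨ (∀ β ∈ F, co β γ ≤ 0)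

namespace RS
variable {Δ : Set E} {F : Finset E} {co : E → E →ₗ[ℝ] ℝ}

lemma ne0 (R : RS Δ F co) {α : E} (h : α ∈ Δ) : α ≠ 0 := fun e => R.zero (e ▸ h)

lemma ipos (R : RS Δ F co) {α : E} (h : α ∈ Δ) : 0 < ⟪α, α⟫ :=
  real_inner_self_pos.2 (R.ne0 h)

lemma co_refl (R : RS Δ F co) {α β : E} (hα : α ∈ F) (hβ : β ∈ F) (h : β ≠ α) (z : E) :
    co β (rrefl α z) = co β z := by
  rw [rrefl_eq, map_sub, map_smul, R.diff α hα β hβ h]; simp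

lemma neg_mem (R : RS Δ F co) {α : E} (h : α ∈ Δ) : -α ∈ Δ := by
  rw [← rrefl_self (R.ne0 h)]; exact R.refl _ h _ h

lemma ext0 (R : RS Δ F co) {z : E} (h : ∀ β ∈ F, co β z = 0) : z = 0 := by
  rw [← R.dec z]
  exact Finset.sum_eq_zero fun β hβ => by rw [h β hβ, zero_smul]

lemma pos_simple (R : RS Δ F co) {α : E} (h : α ∈ F) : ∀ β ∈ F, 0 ≤ co β α := by
  intro β hβ
  by_cases e : β = α
  · subst e; rw [R.same β h]; norm_num
  · rw [R.diff α h β hβ e]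

lemma nonpos (R : RS Δ F co) {α β : E} (hα : α ∈ F) (hβ : β ∈ F) (h : β ≠ α) :
    ⟪α, β⟫ ≤ 0 := by
  by_contra hc
  push Not at hc
  have h1 := R.sign _ (R.refl α (R.sub _ hα) β (R.sub _ hβ))
  have h2 : co β (rrefl α β) = 1 := by rw [R.co_refl hα hβ h, R.same β hβ]
  have h3 : co α (rrefl α β) < 0 := by
    rw [rrefl_eq, map_sub, map_smul, R.same α hα, R.diff β hβ α hα h.symm]
    have := R.ipos (R.sub _ hα)
    have : 0 < 2 * ⟪α, β⟫ / ⟪α, α⟫ := by positivity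
    rw [smul_eq_mul]; linarith
  rcases h1 with h1 | h1
  · exact absurd (h1 α hα) (by linarith)
  · have := h1 β hβ; linarith

lemma pos_refl (R : RS Δ F co) {α γ : E} (hα : α ∈ F) (hγ : γ ∈ Δ) (h : γ ≠ α)
    (hp : ∀ β ∈ F, 0 ≤ co β γ) : ∀ β ∈ F, 0 ≤ co β (rrefl α γ) := by
  have : ∃ β ∈ F, β ≠ α ∧ co β γ ≠ 0 := by
    by_contra hc
    push Not at hc
    have e : γ = co α γ • α := by
      conv_lhs => rw [← R.dec γ]
      exact Finset.sum_eq_single_of_mem α hα fun β hβ hne => by rw [hc β hβ hne, zero_smul]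
    rcases R.red α (R.sub _ hα) (co α γ) (e ▸ hγ) with h1 | h1
    · rw [h1, one_smul] at e; exact h e
    · have := hp α hα; linarith
  obtain ⟨β, hβ, hne, h0⟩ := this
  rcases R.sign _ (R.refl α (R.sub _ hα) γ hγ) with h1 | h1
  · exact h1
  · have h2 := h1 β hβ
    rw [R.co_refl hα hβ hne] at h2
    exact absurd (le_antisymm h2 (hp β hβ)) h0

lemma exch (R : RS Δ F co) : ∀ (L : List E), (∀ a ∈ L, a ∈ F) → ∀ α ∈ F,
    (¬ ∀ β ∈ F, 0 ≤ co β ((L.map rrefl).prod α)) →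
    ∃ L' : List E, (∀ a ∈ L', a ∈ F) ∧ L'.length < L.length ∧
      (L.map rrefl).prod * rrefl α = (L'.map rrefl).prod := by
  intro L
  induction L with
  | nil => intro _ α hα h; exact absurd (R.pos_simple hα) (by simpa using h)
  | cons β M ih =>
    intro hL α hα h
    have hM : ∀ a ∈ M, a ∈ F := fun a ha => hL a (List.mem_cons_of_mem _ ha)
    have hβ : β ∈ F := hL β List.mem_cons_self
    by_cases hm : ∀ β ∈ F, 0 ≤ co β ((M.map rrefl).prod α)
    · have hmem : ∀ (N : List E), (∀ a ∈ N, a ∈ F) → (N.map rrefl).prod α ∈ Δ := by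
        intro N
        induction N with
        | nil => intro _; simpa using R.sub _ hα
        | cons b N ih2 =>
          intro hN
          simp only [List.map_cons, List.prod_cons, liMul]
          exact R.refl _ (R.sub _ (hN b List.mem_cons_self)) _
            (ih2 fun a ha => hN a (List.mem_cons_of_mem _ ha))
      have e : (M.map rrefl).prod α = β := by
        by_contra hne
        apply h
        simp only [List.map_cons, List.prod_cons, liMul]
        exact R.pos_refl hβ (hmem M hM) hne hm
      refine ⟨M, hM, by simp, ?_⟩
      rw [List.map_cons, List.prod_cons, mul_assoc, rrefl_conj, e, ← mul_assoc, rrefl_mul_self,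
        one_mul]
    · obtain ⟨L', h1, h2, h3⟩ := ih hM α hα hm
      refine ⟨β :: L', ?_, by simpa using h2, ?_⟩
      · intro a ha
        rcases List.mem_cons.1 ha with rfl | ha
        · exact hβ
        · exact h1 a ha
      · rw [List.map_cons, List.prod_cons, mul_assoc, h3]; simp

lemma word_one (R : RS Δ F co) : ∀ (n : ℕ) (L : List E), L.length ≤ n → (∀ a ∈ L, a ∈ F) →
    (∀ γ ∈ Δ, (∀ β ∈ F, 0 ≤ co β γ) → ∀ β ∈ F, 0 ≤ co β ((L.map rrefl).prod γ)) →
    (L.map rrefl).prod = 1 := by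
  intro n
  induction n with
  | zero =>
    intro L hL _ _
    have : L = [] := by simpa using hL
    subst this; simp
  | succ n ih =>
    intro L hL hF hp
    rcases List.eq_nil_or_concat' L with rfl | ⟨M, α, rfl⟩
    · simp
    have hα : α ∈ F := hF α (by simp)
    have hM : ∀ a ∈ M, a ∈ F := fun a ha => hF a (by simp [ha])
    have h1 := hp α (R.sub _ hα) (R.pos_simple hα)
    have e : ((M ++ [α]).map rrefl).prod = (M.map rrefl).prod * rrefl α := by simp
    have h2 : ¬ ∀ β ∈ F, 0 ≤ co β ((M.map rrefl).prod α) := by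
      intro h3
      have h4 : (M.map rrefl).prod α = 0 := by
        apply R.ext0
        intro β hβ
        have h5 := h1 β hβ
        rw [e, liMul, rrefl_self (R.ne0 (R.sub _ hα)), map_neg,
          map_neg] at h5
        have := h3 β hβ
        linarith
      exact R.ne0 (R.sub _ hα) (by simpa using h4)
    obtain ⟨L', g1, g2, g3⟩ := R.exch M hM α hα h2
    rw [e, g3]
    apply ih L' _ g1
    · rw [← g3, ← e]; exact hp
    · simp at hL; omega

lemma part (R : RS Δ F co) (P : E → Prop)
    (h : ∀ α ∈ F, ∀ β ∈ F, P α → ¬ P β → ⟪α, β⟫ = 0) :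
    (∀ α ∈ F, P α) ∨ (∀ α ∈ F, ¬ P α) := by
  classical
  set A : Set E := {γ ∈ Δ | ∀ β ∈ F, ¬ P β → co β γ = 0} with hA
  set B : Set E := {γ ∈ Δ | ∀ β ∈ F, P β → co β γ = 0} with hB
  have key : ∀ γ ∈ Δ, (∀ β ∈ F, 0 ≤ co β γ) → γ ∈ A ∪ B := by
    by_contra hc
    push Not at hc
    set S : Set E := {γ ∈ Δ | (∀ β ∈ F, 0 ≤ co β γ) ∧ γ ∉ A ∪ B} with hS
    have hSf : S.Finite := R.fin.subset fun γ hγ => hγ.1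
    have hSn : S.Nonempty := by
      obtain ⟨γ, h1, h2, h3⟩ := hc
      exact ⟨γ, h1, h2, h3⟩
    obtain ⟨γ, ⟨hγ, hp, hn⟩, hmin⟩ := Set.exists_min_image S (fun z => ∑ β ∈ F, co β z) hSf hSn
    obtain ⟨α, hα, hpos⟩ : ∃ α ∈ F, 0 < ⟪α, γ⟫ := by
      by_contra hcc
      push Not at hcc
      have h1 := R.ipos hγ
      have h2 : ⟪γ, γ⟫ = ∑ β ∈ F, co β γ * ⟪β, γ⟫ := by
        conv_lhs => rw [← R.dec γ]
        rw [R.dec γ]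
        conv_lhs => enter [2]; rw [← R.dec γ]
        simp [sum_inner, real_inner_smul_left]
      rw [h2] at h1
      have : ∑ β ∈ F, co β γ * ⟪β, γ⟫ ≤ 0 :=
        Finset.sum_nonpos fun β hβ => mul_nonpos_of_nonneg_of_nonpos (hp β hβ) (hcc β hβ)
      linarith
    have hne : γ ≠ α := by
      rintro rfl
      apply hn
      by_cases hP : P γ
      · left; exact ⟨hγ, fun β hβ hPβ => R.diff γ hα β hβ (by rintro rfl; exact hPβ hP)⟩
      · right; exact ⟨hγ, fun β hβ hPβ => R.diff γ hα β hβ (by rintro rfl; exact hP hPβ)⟩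
    have hm := R.refl α (R.sub _ hα) γ hγ
    have hp' := R.pos_refl hα hγ hne hp
    have hlt : ∑ β ∈ F, co β (rrefl α γ) < ∑ β ∈ F, co β γ := by
      apply Finset.sum_lt_sum
      · intro β hβ
        by_cases e : β = α
        · subst e
          rw [rrefl_eq, map_sub, map_smul, R.same β hα]
          have := R.ipos (R.sub _ hα)
          have : 0 < 2 * ⟪β, γ⟫ / ⟪β, β⟫ := by positivity
          rw [smul_eq_mul]; linarith
        · rw [R.co_refl hα hβ e]
      · refine ⟨α, hα, ?_⟩
        rw [rrefl_eq, map_sub, map_smul, R.same α hα]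
        have := R.ipos (R.sub _ hα)
        have : 0 < 2 * ⟪α, γ⟫ / ⟪α, α⟫ := by positivity
        rw [smul_eq_mul]; linarith
    have hin : rrefl α γ ∈ A ∪ B := by
      by_contra hcc
      have := hmin _ ⟨hm, hp', hcc⟩
      linarith
    have fixed : ⟪α, rrefl α γ⟫ = 0 → False := by
      intro h1
      have h2 : rrefl α (rrefl α γ) = rrefl α γ := by
        rw [rrefl_eq α (rrefl α γ), h1]; simp
      rw [rrefl_invol] at h2
      rw [← h2] at hin
      exact hn hin
    have expand : ∀ z, ⟪α, z⟫ = ∑ β ∈ F, co β z * ⟪α, β⟫ := by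
      intro z
      conv_lhs => rw [← R.dec z]
      simp [inner_sum, real_inner_smul_right]
    rcases hin with hin | hin
    · by_cases hP : P α
      · apply hn; left
        refine ⟨hγ, fun β hβ hPβ => ?_⟩
        rw [← R.co_refl hα hβ (by rintro rfl; exact hPβ hP)]
        exact hin.2 β hβ hPβ
      · apply fixed
        rw [expand]
        apply Finset.sum_eq_zero
        intro β hβ
        by_cases hPβ : P β
        · rw [real_inner_comm, h β hβ α hα hPβ hP, mul_zero]
        · rw [hin.2 β hβ hPβ, zero_mul]
    · by_cases hP : P α
      · apply fixed
        rw [expand]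
        apply Finset.sum_eq_zero
        intro β hβ
        by_cases hPβ : P β
        · rw [hin.2 β hβ hPβ, zero_mul]
        · rw [h α hα β hβ hP hPβ, mul_zero]
      · apply hn; right
        refine ⟨hγ, fun β hβ hPβ => ?_⟩
        rw [← R.co_refl hα hβ (by rintro rfl; exact hP hPβ)]
        exact hin.2 β hβ hPβ
  have hun : A ∪ B = Δ := by
    apply Set.Subset.antisymm
    · rintro z (hz | hz) <;> exact hz.1
    · intro γ hγ
      rcases R.sign γ hγ with hs | hs
      · exact key γ hγ hs
      · have := key (-γ) (R.neg_mem hγ) (fun β hβ => by rw [map_neg]; linarith [hs β hβ])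
        rcases this with h1 | h1
        · left; exact ⟨hγ, fun β hβ hPβ => by simpa using h1.2 β hβ hPβ⟩
        · right; exact ⟨hγ, fun β hβ hPβ => by simpa using h1.2 β hβ hPβ⟩
  have hor : ∀ a ∈ A, ∀ b ∈ B, ⟪a, b⟫ = 0 := by
    intro a ha b hb
    rw [← R.dec a, ← R.dec b]
    simp only [sum_inner, inner_sum, real_inner_smul_left, real_inner_smul_right]
    apply Finset.sum_eq_zero
    intro β hβ
    apply Finset.sum_eq_zero
    intro δ hδ
    by_cases h1 : P β
    · by_cases h2 : P δ
      · simp [hb.2 δ hδ h2, hb.2 β hβ h1]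
      · simp [h β hβ δ hδ h1 h2, real_inner_comm δ β ▸ h β hβ δ hδ h1 h2]
    · by_cases h2 : P δ
      · simp [h δ hδ β hβ h2 h1, real_inner_comm β δ ▸ h δ hδ β hβ h2 h1]
      · simp [ha.2 δ hδ h2, ha.2 β hβ h1]
  rcases R.irr A B hun hor with h1 | h1
  · right
    intro α hα hP
    have : α ∈ A := ⟨R.sub _ hα, fun β hβ hPβ => R.diff α hα β hβ (by rintro rfl; exact hPβ hP)⟩
    rw [h1] at this; exact this
  · left
    intro α hα
    by_contra hP
    have : α ∈ B := ⟨R.sub _ hα, fun β hβ hPβ => R.diff α hα β hβ (by rintro rfl; exact hP hPβ)⟩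
    rw [h1] at this; exact this

end RS
end aux

section aux2
open Finset
variable {E : Type} [NormedAddCommGroup E] [InnerProductSpace ℝ E] [FiniteDimensional ℝ E]

/-- moves between words which do not change the conjugacy class of the product -/
inductive Mv : List E → List E → Prop
  | refl (l : List E) : Mv l l
  | swap (l p : List E) (a b : E) (r : List E) (h : ⟪a, b⟫ = 0) (hm : Mv l (p ++ a :: b :: r)) :
      Mv l (p ++ b :: a :: r)
  | rot (l : List E) (a : E) (t : List E) (hm : Mv l (a :: t)) : Mv l (t ++ [a])

namespace Mv

lemma trans {l m n : List E} (h1 : Mv l m) (h2 : Mv m n) : Mv l n := by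
  induction h2 with
  | refl => exact h1
  | swap p a b r h hm ih => exact Mv.swap _ p a b r h ih
  | rot a t hm ih => exact Mv.rot _ a t ih

lemma perm {l m : List E} (h : Mv l m) : l.Perm m := by
  induction h with
  | refl => exact List.Perm.refl _
  | swap p a b r h hm ih =>
    exact ih.trans (List.Perm.append_left _ (List.Perm.swap _ _ _))
  | rot a t hm ih =>
    exact ih.trans (List.perm_append_singleton a t).symm

lemma conj {l m : List E} (h : Mv l m) : IsConj (l.map rrefl).prod (m.map rrefl).prod := by
  induction h with
  | refl => exact IsConj.refl _
  | swap p a b r h hm ih =>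
    refine ih.trans ?_
    have : (List.map rrefl (p ++ a :: b :: r)).prod = (List.map rrefl (p ++ b :: a :: r)).prod := by
      simp only [List.map_append, List.map_cons, List.prod_append, List.prod_cons]
      rw [← mul_assoc (rrefl a), rrefl_comm h, mul_assoc]
    rw [this]
  | rot a t hm ih =>
    refine ih.trans ?_
    rw [isConj_iff]
    refine ⟨(rrefl a)⁻¹, ?_⟩
    simp

/-- move a letter to the left through a word it commutes with -/
lemma left (v : E) : ∀ (t p : List E), (∀ x ∈ t, ⟪x, v⟫ = 0) → Mv (p ++ (t ++ [v])) (p ++ v :: t) := by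
  intro t
  induction t with
  | nil => intro p _; exact Mv.refl _
  | cons x t ih =>
    intro p h
    have h1 := ih (p ++ [x]) (fun y hy => h y (List.mem_cons_of_mem _ hy))
    simp only [List.append_assoc, List.cons_append, List.nil_append] at h1 ⊢
    exact Mv.swap _ _ _ _ _ (h x List.mem_cons_self) h1

lemma rotN : ∀ (p q : List E), Mv (p ++ q) (q ++ p) := by
  intro p
  induction p with
  | nil => intro q; simpa using Mv.refl q
  | cons a p ih =>
    intro q
    have h1 : Mv (a :: p ++ q) (p ++ (q ++ [a])) := by
      have := Mv.rot _ a (p ++ q) (Mv.refl _)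
      simpa using this
    have h2 := ih (q ++ [a])
    have := h1.trans h2
    simpa using this

lemma lift (v : E) {l m : List E} (h : Mv l m) (hnd : l.Nodup)
    (hv : ∀ a ∈ l, ∀ b ∈ l, ⟪v, a⟫ ≠ 0 → ⟪v, b⟫ ≠ 0 → a = b) : Mv (v :: l) (v :: m) := by
  induction h with
  | refl => exact Mv.refl _
  | swap p a b r h hm ih => exact Mv.swap _ (v :: p) a b r h ih
  | rot a t hm ih =>
    refine ih.trans ?_
    by_cases h0 : ⟪v, a⟫ = 0
    · have h1 : Mv (v :: a :: t) (a :: v :: t) := Mv.swap _ [] v a t h0 (Mv.refl _)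
      have h2 := Mv.rot _ _ _ h1
      simpa using h2
    · have hnd' := hm.perm.nodup_iff.1 hnd
      have h1 : ∀ x ∈ t, ⟪x, v⟫ = 0 := by
        intro x hx
        by_contra hc
        have : x = a := hv x (hm.perm.mem_iff.2 (List.mem_cons_of_mem _ hx)) a
          (hm.perm.mem_iff.2 List.mem_cons_self) (by rwa [real_inner_comm]) h0
        subst this
        exact (List.nodup_cons.1 hnd').1 hx
      have h2 : Mv (v :: a :: t) ([a] ++ (t ++ [v])) := by
        have := Mv.rot _ v (a :: t) (Mv.refl _)
        simpa using this
      have h3 := h2.trans (left v t [a] h1)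
      have h4 := Mv.rot _ _ _ h3
      simpa using h4
end Mv

namespace RS
variable {Δ : Set E} {F : Finset E} {co : E → E →ₗ[ℝ] ℝ}

lemma bond (R : RS Δ F co) {α β : E} (hα : α ∈ F) (hβ : β ∈ F) (h : β ≠ α) (h0 : ⟪α, β⟫ ≠ 0) :
    ‖β‖⁻¹ * ⟪α, β⟫ ≤ - ‖α‖ / 2 := by
  have hn : ⟪α, β⟫ < 0 := lt_of_le_of_ne (R.nonpos hα hβ h) h0
  have pa := R.ipos (R.sub _ hα)
  have pb := R.ipos (R.sub _ hβ)
  obtain ⟨n, e1⟩ := R.crys α (R.sub _ hα) β (R.sub _ hβ)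
  obtain ⟨m, e2⟩ := R.crys β (R.sub _ hβ) α (R.sub _ hα)
  rw [real_inner_comm] at e1
  have n0 : n < 0 := by
    have : (n : ℝ) < 0 := by rw [← e1]; exact div_neg_of_neg_of_pos (by linarith) pa
    exact_mod_cast this
  have m0 : m < 0 := by
    have : (m : ℝ) < 0 := by rw [← e2]; exact div_neg_of_neg_of_pos (by linarith) pb
    exact_mod_cast this
  have hnm : (1 : ℝ) ≤ n * m := by
    have : 1 ≤ n * m := by nlinarith
    exact_mod_cast this
  rw [← e1, ← e2, div_mul_div_comm, le_div_iff₀ (by positivity), one_mul,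
    real_inner_self_eq_norm_sq, real_inner_self_eq_norm_sq] at hnm
  have qa : 0 < ‖α‖ := norm_pos_iff.2 (R.ne0 (R.sub _ hα))
  have qb : 0 < ‖β‖ := norm_pos_iff.2 (R.ne0 (R.sub _ hβ))
  have : ‖α‖ * ‖β‖ ≤ -2 * ⟪α, β⟫ := by
    apply le_of_sq_le_sq _ (by linarith)
    nlinarith
  rw [inv_mul_le_iff₀ qb]
  linarith

lemma leaf (R : RS Δ F co) (S : Finset E) (hS : S ⊆ F) (hne : S.Nonempty) :
    ∃ v ∈ S, ∀ a ∈ S, ∀ b ∈ S, a ≠ v → b ≠ v → ⟪v, a⟫ ≠ 0 → ⟪v, b⟫ ≠ 0 → a = b := by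
  classical
  set z : E := ∑ α ∈ S, ‖α‖⁻¹ • α with hz
  have hz0 : z ≠ 0 := by
    intro h
    obtain ⟨β, hβ⟩ := hne
    have h1 : co β z = ‖β‖⁻¹ := by
      rw [hz, map_sum, Finset.sum_eq_single_of_mem β hβ]
      · rw [map_smul, R.same β (hS hβ)]; simp
      · intro α hα hn
        rw [map_smul, R.diff α (hS hα) β (hS hβ) hn.symm]; simp
    rw [h, map_zero] at h1
    have := R.ne0 (R.sub _ (hS hβ))
    simp at h1
    exact this (norm_eq_zero.1 h1.symm)
  have hpos : 0 < ⟪z, z⟫ := real_inner_self_pos.2 hz0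
  obtain ⟨v, hv, hvz⟩ : ∃ v ∈ S, 0 < ⟪v, z⟫ := by
    by_contra hc
    push Not at hc
    have h2 : ⟪z, z⟫ = ∑ α ∈ S, ‖α‖⁻¹ * ⟪α, z⟫ := by
      conv_lhs => enter [2]; rw [hz]
      simp [sum_inner, real_inner_smul_left]
    have : ∑ α ∈ S, ‖α‖⁻¹ * ⟪α, z⟫ ≤ 0 :=
      Finset.sum_nonpos fun β hβ => mul_nonpos_of_nonneg_of_nonpos (by positivity) (hc β hβ)
    linarith
  refine ⟨v, hv, fun a ha b hb hav hbv ha0 hb0 => ?_⟩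
  by_contra hab
  have h3 : ⟪v, z⟫ = ∑ α ∈ S, ‖α‖⁻¹ * ⟪v, α⟫ := by
    rw [hz]
    simp [inner_sum, real_inner_smul_right]
  have h4 : ∑ α ∈ S, ‖α‖⁻¹ * ⟪v, α⟫ ≤ ∑ α ∈ ({v, a, b} : Finset E), ‖α‖⁻¹ * ⟪v, α⟫ := by
    apply Finset.sum_le_sum_of_subset_of_nonpos'
    · intro x hx
      simp only [Finset.mem_insert, Finset.mem_singleton] at hx
      rcases hx with rfl | rfl | rfl <;> assumption
    · intro x hx hx'
      simp only [Finset.mem_insert, Finset.mem_singleton, not_or] at hx'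
      exact mul_nonpos_of_nonneg_of_nonpos (by positivity) (R.nonpos (hS hv) (hS hx) hx'.1)
  rw [Finset.sum_insert (by simp [hav.symm, hbv.symm]), Finset.sum_pair hab] at h4
  have h5 := R.bond (hS hv) (hS ha) hav ha0
  have h6 := R.bond (hS hv) (hS hb) hbv hb0
  have h7 : ‖v‖⁻¹ * ⟪v, v⟫ = ‖v‖ := by
    rw [real_inner_self_eq_norm_sq]
    have : ‖v‖ ≠ 0 := norm_ne_zero_iff.2 (R.ne0 (R.sub _ (hS hv)))
    field_simp
  linarith

lemma bipart (R : RS Δ F co) : ∀ (n : ℕ) (l : List E), l.length = n → l.Nodup → (∀ a ∈ l, a ∈ F) →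
    ∃ A B : List E, A.Pairwise (fun a b => ⟪a, b⟫ = 0) ∧ B.Pairwise (fun a b => ⟪a, b⟫ = 0) ∧
      Mv l (A ++ B) := by
  classical
  intro n
  induction n with
  | zero =>
    intro l hl _ _
    have : l = [] := by simpa using hl
    subst this
    exact ⟨[], [], by simp, by simp, Mv.refl _⟩
  | succ n ih =>
    intro l hl hnd hF
    obtain ⟨v, hv, hleaf⟩ := R.leaf l.toFinset (fun a ha => hF a (List.mem_toFinset.1 ha)) (by
      rcases l with _ | ⟨a, t⟩
      · simp at hl
      · exact ⟨a, by simp⟩)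
    rw [List.mem_toFinset] at hv
    obtain ⟨p, q, rfl⟩ := List.append_of_mem hv
    have h1 : Mv (p ++ v :: q) (v :: (q ++ p)) := by simpa using Mv.rotN p (v :: q)
    have hnd1 := h1.perm.nodup_iff.1 hnd
    have hnd2 := List.nodup_cons.1 hnd1
    have hmem : ∀ a ∈ q ++ p, a ∈ (p ++ v :: q).toFinset ∧ a ≠ v := by
      intro a ha
      refine ⟨?_, ?_⟩
      · rw [List.mem_toFinset, h1.perm.mem_iff]; exact List.mem_cons_of_mem _ ha
      · rintro rfl; exact hnd2.1 ha
    obtain ⟨A, B, hA, hB, hm⟩ := ih (q ++ p) (by simp at hl ⊢; omega) hnd2.2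
      (fun a ha => hF a (List.mem_toFinset.1 (hmem a ha).1))
    have hm2 : ∀ a ∈ A ++ B, a ∈ q ++ p := fun a ha => hm.perm.mem_iff.2 ha
    have hnd3 := hm.perm.nodup_iff.1 hnd2.2
    have h2 := h1.trans (hm.lift v hnd2.2 (fun a ha b hb ha0 hb0 =>
      hleaf a (hmem a ha).1 b (hmem b hb).1 (hmem a ha).2 (hmem b hb).2 ha0 hb0))
    by_cases hAv : ∀ a ∈ A, ⟪v, a⟫ = 0
    · exact ⟨v :: A, B, List.pairwise_cons.2 ⟨hAv, hA⟩, hB, h2⟩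
    · push Not at hAv
      obtain ⟨a, ha, ha0⟩ := hAv
      refine ⟨A, B ++ [v], hA, ?_, ?_⟩
      · rw [List.pairwise_append]
        refine ⟨hB, by simp, ?_⟩
        intro b hb c hc
        have : c = v := by simpa using hc
        subst this
        by_contra hc0
        have hb' : b ∈ A ++ B := by simp [hb]
        have ha' : a ∈ A ++ B := by simp [ha]
        have h3 := hleaf a (hmem a (hm2 a ha')).1 b (hmem b (hm2 b hb')).1
          (hmem a (hm2 a ha')).2 (hmem b (hm2 b hb')).2 ha0 (by rwa [real_inner_comm])
        subst h3
        exact (List.nodup_append.1 hnd3).2.2 a ha a hb rfl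
      · have := Mv.rot _ _ _ h2
        simpa using this

end RS
end aux2

section aux3
open Finset
variable {E : Type} [NormedAddCommGroup E] [InnerProductSpace ℝ E] [FiniteDimensional ℝ E]
namespace RS
variable {Δ : Set E} {F : Finset E} {co : E → E →ₗ[ℝ] ℝ}

lemma co_sum (R : RS Δ F co) (f : E → ℝ) {β : E} (hβ : β ∈ F) :
    co β (∑ α ∈ F, f α • α) = f β := by
  rw [map_sum, Finset.sum_eq_single_of_mem β hβ]
  · rw [map_smul, R.same β hβ]; simp
  · intro α hα hn
    rw [map_smul, R.diff α hα β hβ hn.symm]; simp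

lemma pf (R : RS Δ F co) (hne : F.Nonempty) : ∃ (w : E → ℝ) (κ : ℝ), (∀ α ∈ F, 0 < w α) ∧ 0 < κ ∧
    ∀ α ∈ F, ⟪α, ∑ β ∈ F, w β • β⟫ = κ * (w α * ⟪α, α⟫) := by
  classical
  set N : E → ℝ := fun z => ∑ β ∈ F, (co β z) ^ 2 * ⟪β, β⟫ with hN
  have hcont : Continuous N := by
    apply continuous_finset_sum
    intro β _
    exact ((LinearMap.continuous_of_finiteDimensional (co β)).pow 2).mul continuous_const
  obtain ⟨α₀, hα₀⟩ := hne
  have hα₀n : α₀ ≠ 0 := R.ne0 (R.sub _ hα₀)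
  have hsn : (Metric.sphere (0 : E) 1).Nonempty :=
    ⟨‖α₀‖⁻¹ • α₀, by simp [norm_smul, hα₀n]⟩
  obtain ⟨X₀, hX₀, hmax⟩ := (isCompact_sphere (0 : E) 1).exists_isMaxOn hsn hcont.continuousOn
  set ν := N X₀ with hν
  have nsmul : ∀ (t : ℝ) z, N (t • z) = t ^ 2 * N z := by
    intro t z
    simp only [hN, map_smul, smul_eq_mul, Finset.mul_sum]
    exact Finset.sum_congr rfl fun β _ => by ring
  have hle : ∀ z, N z ≤ ν * ⟪z, z⟫ := by
    intro z
    by_cases hz : z = 0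
    · subst hz; simp [hN]
    · have h1 : N (‖z‖⁻¹ • z) ≤ ν := hmax (by simp [norm_smul, hz])
      rw [nsmul] at h1
      have h2 : 0 < ‖z‖ := norm_pos_iff.2 hz
      rw [real_inner_self_eq_norm_sq]
      rw [inv_pow, inv_mul_le_iff₀ (by positivity)] at h1
      linarith
  have hX1 : ⟪X₀, X₀⟫ = 1 := by
    rw [real_inner_self_eq_norm_sq]
    have : ‖X₀‖ = 1 := by simpa using hX₀
    rw [this]; norm_num
  have hνpos : 0 < ν := by
    have h1 : 0 < N α₀ := by
      apply Finset.sum_pos'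
      · intro β hβ
        have := R.ipos (R.sub _ hβ)
        positivity
      · refine ⟨α₀, hα₀, ?_⟩
        rw [R.same _ hα₀]
        have := R.ipos (R.sub _ hα₀)
        positivity
    have h2 := hle α₀
    have h3 := R.ipos (R.sub _ hα₀)
    by_contra hc
    push Not at hc
    nlinarith
  set X : E := ∑ β ∈ F, |co β X₀| • β with hX
  have coX : ∀ β ∈ F, co β X = |co β X₀| := fun β hβ => R.co_sum _ hβ
  have NX : N X = ν := by
    rw [hν]
    apply Finset.sum_congr rfl
    intro β hβ
    rw [coX β hβ, sq_abs]
  have hXle : ⟪X, X⟫ ≤ 1 := by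
    rw [← hX1]
    have e1 : ⟪X₀, X₀⟫ = ∑ α ∈ F, ∑ β ∈ F, co α X₀ * (co β X₀ * ⟪β, α⟫) := by
      conv_lhs => rw [← R.dec X₀]
      simp only [sum_inner, inner_sum, real_inner_smul_left, real_inner_smul_right]
    have e2 : ⟪X, X⟫ = ∑ α ∈ F, ∑ β ∈ F, |co α X₀| * (|co β X₀| * ⟪β, α⟫) := by
      rw [hX]
      simp only [sum_inner, inner_sum, real_inner_smul_left, real_inner_smul_right]
    rw [e1, e2]
    apply Finset.sum_le_sum
    intro α hα
    apply Finset.sum_le_sum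
    intro β hβ
    by_cases e : α = β
    · subst e
      rw [← mul_assoc, ← mul_assoc, abs_mul_abs_self]
    · rw [← mul_assoc, ← mul_assoc, ← abs_mul]
      exact mul_le_mul_of_nonpos_right (le_abs_self _) (R.nonpos hβ hα e)
  have hXeq : N X = ν * ⟪X, X⟫ := by
    apply le_antisymm (hle X)
    rw [NX]; nlinarith
  -- bilinear extremality
  have hbil : ∀ z, ∑ β ∈ F, co β X * co β z * ⟪β, β⟫ = ν * ⟪X, z⟫ := by
    intro z
    set b := ∑ β ∈ F, co β X * co β z * ⟪β, β⟫ with hb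
    have hq : ∀ t : ℝ, 0 ≤ (ν * ⟪z, z⟫ - N z) * (t * t) + (2 * (ν * ⟪X, z⟫ - b)) * t + 0 := by
      intro t
      have h1 := hle (X + t • z)
      have h2 : N (X + t • z) = N X + 2 * t * b + t ^ 2 * N z := by
        simp only [hN, hb, map_add, map_smul, smul_eq_mul, Finset.mul_sum,
          ← Finset.sum_add_distrib]
        exact Finset.sum_congr rfl fun β _ => by ring
      have h3 : ⟪X + t • z, X + t • z⟫ = ⟪X, X⟫ + 2 * t * ⟪X, z⟫ + t ^ 2 * ⟪z, z⟫ := by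
        simp only [inner_add_left, inner_add_right, real_inner_smul_left, real_inner_smul_right]
        rw [real_inner_comm X z]; ring
      rw [h2, h3, hXeq] at h1
      linarith
    have hd := discrim_le_zero hq
    unfold discrim at hd
    have : (2 * (ν * ⟪X, z⟫ - b)) ^ 2 ≤ 0 := by linarith
    have := pow_eq_zero_iff (two_ne_zero) |>.1 (le_antisymm this (sq_nonneg _))
    linarith
  have heig : ∀ α ∈ F, co α X * ⟪α, α⟫ = ν * ⟪X, α⟫ := by
    intro α hα
    rw [← hbil α, Finset.sum_eq_single_of_mem α hα]
    · rw [R.same α hα, mul_one]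
    · intro β hβ hn
      rw [R.diff α hα β hβ hn]; simp
  have hX0 : X ≠ 0 := by
    intro h
    rw [h] at NX
    simp [hN] at NX
    linarith
  have hnn : ∀ β ∈ F, 0 ≤ co β X := fun β hβ => by rw [coX β hβ]; exact abs_nonneg _
  have hpos : ∀ β ∈ F, 0 < co β X := by
    rcases R.part (fun α => co α X = 0) (by
      intro α hα β hβ h1 h2
      have h3 := heig α hα
      rw [h1, zero_mul] at h3
      have h4 : ⟪X, α⟫ = 0 := by
        rcases mul_eq_zero.1 h3.symm with h | h
        · linarith
        · exact h
      have h5 : ⟪X, α⟫ = ∑ δ ∈ F, co δ X * ⟪α, δ⟫ := by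
        conv_lhs => rw [← R.dec X]
        simp only [sum_inner, real_inner_smul_left]
        exact Finset.sum_congr rfl fun δ _ => by rw [real_inner_comm]
      rw [h5] at h4
      have h6 : ∀ δ ∈ F, co δ X * ⟪α, δ⟫ ≤ 0 := by
        intro δ hδ
        by_cases e : δ = α
        · subst e; rw [h1, zero_mul]
        · exact mul_nonpos_of_nonneg_of_nonpos (hnn δ hδ) (R.nonpos hα hδ e)
      have h7 := (Finset.sum_eq_zero_iff_of_nonpos h6).1 h4 β hβ
      exact (mul_eq_zero.1 h7).resolve_left h2) with h | h
    · exact absurd (R.ext0 h) hX0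
    · exact fun β hβ => lt_of_le_of_ne (hnn β hβ) (Ne.symm (h β hβ))
  refine ⟨fun β => co β X, ν⁻¹, hpos, by positivity, fun α hα => ?_⟩
  rw [R.dec X, heig α hα, real_inner_comm]
  field_simp

end RS
end aux3

section aux4
open Finset
variable {E : Type} [NormedAddCommGroup E] [InnerProductSpace ℝ E] [FiniteDimensional ℝ E]

lemma prod_orth [DecidableEq E] (z : E) : ∀ (A : List E), A.Nodup → A.Pairwise (fun a b => ⟪a, b⟫ = 0) →
    (A.map rrefl).prod z = z - ∑ a ∈ A.toFinset, (2 * ⟪a, z⟫ / ⟪a, a⟫) • a := by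
  intro A
  induction A with
  | nil => intro _ _; simp
  | cons a M ih =>
    intro hn hp
    rw [List.nodup_cons] at hn
    rw [List.pairwise_cons] at hp
    rw [List.map_cons, List.prod_cons, liMul, ih hn.2 hp.2, List.toFinset_cons,
      Finset.sum_insert (by simpa using hn.1), rrefl_eq]
    have : ⟪a, z - ∑ a ∈ M.toFinset, (2 * ⟪a, z⟫ / ⟪a, a⟫) • a⟫ = ⟪a, z⟫ := by
      rw [inner_sub_right, inner_sum, Finset.sum_eq_zero, sub_zero]
      intro b hb
      rw [real_inner_smul_right, hp.1 b (by simpa using hb), mul_zero]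
    rw [this]
    abel

lemma trig_zero {θ : ℝ} {K : ℕ} (hK : (K : ℝ) * θ = Real.pi) (hθ : 0 < Real.sin θ) (N : ℤ)
    (h0 : Real.sin (N * θ) = 0)
    (h1 : 0 < Real.sin ((N + 1) * θ) ∨ Real.sin ((N - 1) * θ) < 0)
    (hl : -1 ≤ N) (hu : N ≤ 2 * K - 1) : N = 0 := by
  have hc : 0 < Real.cos (N * θ) := by
    rcases h1 with h1 | h1
    · rw [add_mul, one_mul, Real.sin_add, h0, zero_mul, zero_add] at h1
      exact pos_of_mul_pos_left h1 hθ.le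
    · rw [sub_mul, one_mul, Real.sin_sub, h0, zero_mul, zero_sub] at h1
      exact pos_of_mul_pos_left (by linarith) hθ.le
  have hc1 : Real.cos (N * θ) = 1 := by
    have := Real.sin_sq_add_cos_sq (N * θ)
    rw [h0] at this
    nlinarith
  obtain ⟨n, hn⟩ := (Real.cos_eq_one_iff _).1 hc1
  have hθ0 : θ ≠ 0 := by rintro rfl; simp at hθ
  have e : (N : ℝ) = 2 * K * n := by
    apply mul_right_cancel₀ hθ0
    rw [← hn, ← hK]; ring
  have e' : N = 2 * K * n := by exact_mod_cast e
  have hK0 : 0 < (K : ℤ) := by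
    rcases Nat.eq_zero_or_pos K with h | h
    · subst h; simp at hK; exact absurd hK.symm Real.pi_ne_zero
    · exact_mod_cast h
  have n1 : n < 1 := by by_contra h; push Not at h; nlinarith
  have n2 : -1 < n := by by_contra h; push Not at h; nlinarith
  have : n = 0 := by omega
  rw [e', this, mul_zero]

lemma trig_exists {θ : ℝ} (h0 : 0 < θ) (h1 : θ < Real.pi)
    (h : ∀ j : ℕ, 0 ≤ Real.sin (j * θ) * Real.sin ((j + 1) * θ)) :
    ∃ K : ℕ, (K : ℝ) * θ = Real.pi := by
  set K := ⌈Real.pi / θ⌉₊ with hK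
  have hle : Real.pi ≤ K * θ := by
    rw [← div_le_iff₀ h0]; exact Nat.le_ceil _
  have hpos : 0 < Real.pi / θ := by positivity
  have hlt : (K : ℝ) * θ < Real.pi + θ := by
    have := Nat.ceil_lt_add_one hpos.le
    rw [← hK] at this
    calc (K : ℝ) * θ < (Real.pi / θ + 1) * θ := by gcongr
      _ = Real.pi + θ := by field_simp
  refine ⟨K, le_antisymm ?_ hle⟩
  by_contra hc
  push Not at hc
  have hK1 : 1 < K := by
    by_contra hh
    push Not at hh
    have : (K : ℝ) ≤ 1 := by exact_mod_cast hh
    nlinarith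
  obtain ⟨k, hk⟩ : ∃ k, K = k + 1 := ⟨K - 1, by omega⟩
  have h2 := h k
  have hkp : 0 < (k : ℝ) := by
    have : 0 < k := by omega
    exact_mod_cast this
  rw [hk] at hlt hc
  push_cast at hlt hc
  have s1 : 0 < Real.sin (k * θ) := Real.sin_pos_of_pos_of_lt_pi (by positivity) (by linarith)
  have s2 : Real.sin ((k + 1) * θ) < 0 := by
    rw [← Real.sin_sub_two_pi]
    exact Real.sin_neg_of_neg_of_neg_pi_lt (by linarith) (by linarith)
  nlinarith

namespace RS
variable {Δ : Set E} {F : Finset E} {co : E → E →ₗ[ℝ] ℝ}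

lemma single (R : RS Δ F co) {S : Finset E} (hS : S ⊆ F)
    (ho : ∀ a ∈ S, ∀ b ∈ S, a ≠ b → ⟪a, b⟫ = 0) {γ : E} (hγ : γ ∈ Δ)
    (hp : ∀ β ∈ F, 0 ≤ co β γ) (hz : ∀ β ∈ F, β ∉ S → co β γ = 0) : γ ∈ S := by
  classical
  obtain ⟨a, ha, ha0⟩ : ∃ a ∈ F, co a γ ≠ 0 := by
    by_contra hc
    push Not at hc
    exact R.ne0 hγ (R.ext0 hc)
  have haS : a ∈ S := by
    by_contra h; exact ha0 (hz a ha h)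
  have hpos : 0 < co a γ := lt_of_le_of_ne (hp a ha) ha0.symm
  by_cases e : γ = a
  · rw [e]; exact haS
  exfalso
  have h1 := R.pos_refl ha hγ e hp a ha
  have h2 : ⟪a, γ⟫ = co a γ * ⟪a, a⟫ := by
    conv_lhs => rw [← R.dec γ]
    rw [inner_sum, Finset.sum_eq_single_of_mem a ha, real_inner_smul_right]
    intro b hb hne
    rw [real_inner_smul_right]
    by_cases hbS : b ∈ S
    · rw [ho a haS b hbS hne.symm, mul_zero]
    · rw [hz b hb hbS, zero_mul]
  have h3 := R.ipos (R.sub _ ha)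
  rw [rrefl_eq, map_sub, map_smul, R.same a ha, h2, smul_eq_mul, mul_one, ← mul_assoc,
    mul_div_assoc, div_self h3.ne'] at h1
  linarith

lemma trans_mem (R : RS Δ F co) {S T : Finset E} (hS : S ⊆ F) (hT : T ⊆ F)
    (hF : ∀ a ∈ F, a ∉ S → a ∈ T)
    (ho : ∀ a ∈ S, ∀ b ∈ S, a ≠ b → ⟪a, b⟫ = 0) (W : E → ℝ) (hW : ∀ a ∈ F, 0 < W a)
    {γ : E} (hγ : γ ∈ Δ)
    (h1 : ∑ β ∈ T, co β γ * W β ≤ 0) (h2 : 0 < ∑ β ∈ S, co β γ * W β) : γ ∈ S := by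
  have hp : ∀ β ∈ F, 0 ≤ co β γ := by
    rcases R.sign γ hγ with h | h
    · exact h
    · exfalso
      have : ∑ β ∈ S, co β γ * W β ≤ 0 := Finset.sum_nonpos fun β hβ =>
        mul_nonpos_of_nonpos_of_nonneg (h β (hS hβ)) (hW β (hS hβ)).le
      linarith
  apply R.single hS ho hγ hp
  intro β hβ hβS
  have hβT := hF β hβ hβS
  have h3 : ∀ δ ∈ T, 0 ≤ co δ γ * W δ := fun δ hδ => mul_nonneg (hp δ (hT hδ)) (hW δ (hT hδ)).le
  have h4 := (Finset.sum_eq_zero_iff_of_nonneg h3).1 (le_antisymm h1 (Finset.sum_nonneg h3)) β hβT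
  exact (mul_eq_zero.1 h4).resolve_right (hW β hβ).ne'

lemma count (R : RS Δ F co) (A B : Finset E) (hAF : A ⊆ F) (hBF : B ⊆ F)
    (hFAB : ∀ a ∈ F, a ∈ A ∨ a ∈ B) (hdis : ∀ a ∈ A, a ∉ B) (hAne : A.Nonempty)
    (hAo : ∀ a ∈ A, ∀ b ∈ A, a ≠ b → ⟪a, b⟫ = 0)
    (hBo : ∀ a ∈ B, ∀ b ∈ B, a ≠ b → ⟪a, b⟫ = 0)
    (sA sB : E ≃ₗᵢ[ℝ] E) (hsA : ∀ γ ∈ Δ, sA γ ∈ Δ) (hsB : ∀ γ ∈ Δ, sB γ ∈ Δ)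
    (hsBB : ∀ b ∈ B, sB b = -b)
    (L : List E) (hL : ∀ a ∈ L, a ∈ F) (hLp : (L.map rrefl).prod = sA * sB)
    (W : E → ℝ) (hW : ∀ a ∈ F, 0 < W a) (f g : E → ℝ)
    (hf : ∀ z, f z = ∑ β ∈ B, co β z * W β) (hg : ∀ z, g z = ∑ β ∈ A, co β z * W β)
    (μ : ℝ) (hμ0 : 0 < μ) (hμ1 : μ < 1)
    (h1 : ∀ z, f (sA z) = f z) (h2 : ∀ z, g (sA z) = 2 * μ * f z - g z)
    (h3 : ∀ z, f (sB z) = 2 * μ * g z - f z) (h4 : ∀ z, g (sB z) = g z) (l : ℝ) :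
    {α ∈ Δ | ‖α‖ = l}.ncard = orderOf (sA * sB) * {α | α ∈ F ∧ ‖α‖ = l}.ncard := by
  classical
  set c := sA * sB with hc
  set θ := Real.arccos μ with hθ
  have hcos : Real.cos θ = μ := Real.cos_arccos (by linarith) hμ1.le
  have hθ0 : 0 < θ := Real.arccos_pos.2 hμ1
  have hθ1 : θ < Real.pi := by
    have := Real.arccos_lt_pi_div_two.2 hμ0
    have := Real.pi_pos
    linarith
  have hsin : 0 < Real.sin θ := Real.sin_pos_of_pos_of_lt_pi hθ0 hθ1
  have rec3 : ∀ x : ℝ, Real.sin (x + θ) = 2 * μ * Real.sin x - Real.sin (x - θ) := by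
    intro x
    rw [Real.sin_add, Real.sin_sub, hcos]; ring
  -- trajectories
  have hcm : ∀ (k : ℕ), ∀ γ ∈ Δ, (c ^ k) γ ∈ Δ := by
    intro k
    induction k with
    | zero => intro γ h; simpa using h
    | succ k ih => intro γ h; rw [pow_succ', liMul]; exact hsA _ (hsB _ (ih γ h))
  have traj : ∀ (z : E) (k : ℕ),
      f ((c ^ k) z) * Real.sin θ = g z * Real.sin (2 * k * θ) - f z * Real.sin (2 * k * θ - θ) ∧
      g ((c ^ k) z) * Real.sin θ = g z * Real.sin (2 * k * θ + θ) - f z * Real.sin (2 * k * θ) := by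
    intro z k
    induction k with
    | zero => simp
    | succ k ih =>
      obtain ⟨i1, i2⟩ := ih
      rw [pow_succ', liMul]
      set y := (c ^ k) z
      have e1 : f (c y) = 2 * μ * g y - f y := by rw [hc, liMul, h1, h3]
      have e2 : g (c y) = 2 * μ * (2 * μ * g y - f y) - g y := by rw [hc, liMul, h2, h3, h4]
      have r1 := rec3 (2 * k * θ)
      have r2 := rec3 (2 * k * θ + θ)
      have r3 := rec3 (2 * k * θ + θ + θ)
      rw [add_sub_cancel_right] at r2 r3
      have x1 : 2 * ((k + 1 : ℕ) : ℝ) * θ = 2 * k * θ + θ + θ := by push_cast; ring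
      rw [x1, add_sub_cancel_right, e1, e2]
      constructor
      · rw [r2]; linear_combination 2 * μ * i2 - i1 + f z * r1
      · rw [r3, r2]
        linear_combination (4 * μ ^ 2 - 1) * i2 - 2 * μ * i1 + 2 * μ * f z * r1
  have sgn : ∀ γ ∈ Δ, (0 ≤ f γ ∧ 0 ≤ g γ ∧ 0 < f γ + g γ) ∨ (f γ ≤ 0 ∧ g γ ≤ 0 ∧ f γ + g γ < 0) := by
    have aux : ∀ γ ∈ Δ, (∀ β ∈ F, 0 ≤ co β γ) → (0 ≤ f γ ∧ 0 ≤ g γ ∧ 0 < f γ + g γ) := by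
      intro γ hγ hp
      have q1 : ∀ β ∈ B, 0 ≤ co β γ * W β := fun β hβ => mul_nonneg (hp β (hBF hβ)) (hW β (hBF hβ)).le
      have q2 : ∀ β ∈ A, 0 ≤ co β γ * W β := fun β hβ => mul_nonneg (hp β (hAF hβ)) (hW β (hAF hβ)).le
      have f0 : 0 ≤ f γ := by rw [hf]; exact Finset.sum_nonneg q1
      have g0 : 0 ≤ g γ := by rw [hg]; exact Finset.sum_nonneg q2
      refine ⟨f0, g0, lt_of_le_of_ne (by linarith) ?_⟩
      intro h
      have hf0 : f γ = 0 := by linarith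
      have hg0 : g γ = 0 := by linarith
      rw [hf] at hf0
      rw [hg] at hg0
      apply R.ne0 hγ
      apply R.ext0
      intro β hβ
      rcases hFAB β hβ with h' | h'
      · exact (mul_eq_zero.1 ((Finset.sum_eq_zero_iff_of_nonneg q2).1 hg0 β h')).resolve_right
          (hW β hβ).ne'
      · exact (mul_eq_zero.1 ((Finset.sum_eq_zero_iff_of_nonneg q1).1 hf0 β h')).resolve_right
          (hW β hβ).ne'
    intro γ hγ
    rcases R.sign γ hγ with h | h
    · left; exact aux γ hγ h
    · right
      have := aux (-γ) (R.neg_mem hγ) (fun β hβ => by rw [map_neg]; linarith [h β hβ])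
      have e1 : f (-γ) = - f γ := by rw [hf, hf]; simp
      have e2 : g (-γ) = - g γ := by rw [hg, hg]; simp
      rw [e1, e2] at this
      refine ⟨?_, ?_, ?_⟩ <;> linarith [this.1, this.2.1, this.2.2]
  have sgnm : ∀ γ ∈ Δ, 0 ≤ f γ * g γ := by
    intro γ hγ
    rcases sgn γ hγ with h | h
    · exact mul_nonneg h.1 h.2.1
    · exact mul_nonneg_of_nonpos_of_nonpos h.1 h.2.1
  -- values on simple roots
  have valA : ∀ a ∈ A, f a = 0 ∧ g a = W a := by
    intro a ha
    constructor
    · rw [hf]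
      apply Finset.sum_eq_zero
      intro b hb
      rw [R.diff a (hAF ha) b (hBF hb) (by rintro rfl; exact hdis _ ha hb), zero_mul]
    · rw [hg, Finset.sum_eq_single_of_mem a ha, R.same a (hAF ha), one_mul]
      intro b hb hn
      rw [R.diff a (hAF ha) b (hAF hb) hn, zero_mul]
  have valB : ∀ a ∈ B, f (-a) = - W a ∧ g (-a) = 0 := by
    intro a ha
    constructor
    · rw [hf, Finset.sum_eq_single_of_mem a ha, map_neg, R.same a (hBF ha), neg_one_mul]
      intro b hb hn
      rw [map_neg, R.diff a (hBF ha) b (hBF hb) hn, neg_zero, zero_mul]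
    · rw [hg]
      apply Finset.sum_eq_zero
      intro b hb
      rw [map_neg, R.diff a (hBF ha) b (hAF hb) (by rintro rfl; exact hdis _ hb ha), neg_zero,
        zero_mul]
  obtain ⟨K, hK⟩ : ∃ K : ℕ, (K : ℝ) * θ = Real.pi := by
    apply trig_exists hθ0 hθ1
    obtain ⟨a, ha⟩ := hAne
    obtain ⟨va, vb⟩ := valA a ha
    have Wp := hW a (hAF ha)
    have sc : ∀ x y p q : ℝ, p * Real.sin θ = W a * x → q * Real.sin θ = W a * y → 0 ≤ p * q →
        0 ≤ x * y := by
      intro x y p q hp hq hpq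
      have : 0 ≤ (W a * W a) * (x * y) := by
        have e : (W a * W a) * (x * y) = (Real.sin θ * Real.sin θ) * (p * q) := by
          calc (W a * W a) * (x * y) = (W a * x) * (W a * y) := by ring
            _ = _ := by rw [← hp, ← hq]; ring
        rw [e]; positivity
      exact nonneg_of_mul_nonneg_right this (by positivity)
    intro j
    rcases Nat.even_or_odd' j with ⟨k, rfl | rfl⟩
    · obtain ⟨t1, t2⟩ := traj a k
      rw [va, vb, zero_mul, sub_zero] at t1 t2
      have := sc _ _ _ _ t1 t2 (sgnm _ (hcm k a (R.sub _ (hAF ha))))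
      push_cast
      rwa [add_mul, one_mul]
    · obtain ⟨t1, t2⟩ := traj a k
      rw [va, vb, zero_mul, sub_zero] at t1 t2
      have r2 := rec3 (2 * k * θ + θ)
      rw [add_sub_cancel_right] at r2
      have t3 : f (sB ((c ^ k) a)) * Real.sin θ = W a * Real.sin (2 * k * θ + θ + θ) := by
        rw [h3, r2]; linear_combination 2 * μ * t2 - t1
      have t4 : g (sB ((c ^ k) a)) * Real.sin θ = W a * Real.sin (2 * k * θ + θ) := by
        rw [h4, t2]
      have := sc _ _ _ _ t3 t4 (sgnm _ (hsB _ (hcm k a (R.sub _ (hAF ha)))))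
      rw [mul_comm] at this
      push_cast
      convert this using 3 <;> ring
  have hKpos : 0 < K := by
    rcases Nat.eq_zero_or_pos K with h | h
    · subst h; simp at hK; exact absurd hK.symm Real.pi_ne_zero
    · exact h
  -- c ^ K = 1
  have hcK : c ^ K = 1 := by
    have e : ((List.replicate K L).flatten.map rrefl).prod = c ^ K := by
      rw [List.map_flatten, List.prod_flatten]
      simp [hLp, hc]
    rw [← e]
    apply R.word_one _ _ le_rfl
    · intro a ha
      rw [List.mem_flatten] at ha
      obtain ⟨M, hM, haM⟩ := ha
      rw [List.eq_of_mem_replicate hM] at haM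
      exact hL a haM
    · rw [e]
      intro γ hγ hp
      have x1 : 2 * (K : ℝ) * θ = 2 * Real.pi := by rw [mul_assoc, hK]
      obtain ⟨t1, t2⟩ := traj γ K
      rw [x1, Real.sin_two_pi, Real.sin_two_pi_sub] at t1
      rw [x1, Real.sin_two_pi, add_comm, Real.sin_add_two_pi] at t2
      have e1 : f ((c ^ K) γ) = f γ := by
        apply mul_right_cancel₀ hsin.ne'; linear_combination t1
      have e2 : g ((c ^ K) γ) = g γ := by
        apply mul_right_cancel₀ hsin.ne'; linear_combination t2
      rcases R.sign _ (hcm K γ hγ) with h | h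
      · exact h
      · exfalso
        have s1 : f ((c ^ K) γ) ≤ 0 := by
          rw [hf]
          exact Finset.sum_nonpos fun β hβ =>
            mul_nonpos_of_nonpos_of_nonneg (h β (hBF hβ)) (hW β (hBF hβ)).le
        have s2 : g ((c ^ K) γ) ≤ 0 := by
          rw [hg]
          exact Finset.sum_nonpos fun β hβ =>
            mul_nonpos_of_nonpos_of_nonneg (h β (hAF hβ)) (hW β (hAF hβ)).le
        have s3 : 0 ≤ f γ := by
          rw [hf]
          exact Finset.sum_nonneg fun β hβ => mul_nonneg (hp β (hBF hβ)) (hW β (hBF hβ)).le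
        have s4 : 0 ≤ g γ := by
          rw [hg]
          exact Finset.sum_nonneg fun β hβ => mul_nonneg (hp β (hAF hβ)) (hW β (hAF hβ)).le
        rcases sgn γ hγ with h' | h' <;> linarith [h'.2.2]
  set ε : E → E := fun α => if α ∈ A then α else -α with hε
  have εmem : ∀ α ∈ F, ε α ∈ Δ := by
    intro α hα
    simp only [hε]
    split_ifs
    · exact R.sub _ hα
    · exact R.neg_mem (R.sub _ hα)
  have traj2 : ∀ α ∈ F, ∃ i : ℤ, (i = 0 ∨ i = 1) ∧ ∀ k : ℕ,
      f ((c ^ k) (ε α)) * Real.sin θ = W α * Real.sin (((2 * k - i : ℤ) : ℝ) * θ) ∧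
      g ((c ^ k) (ε α)) * Real.sin θ = W α * Real.sin (((2 * k + 1 - i : ℤ) : ℝ) * θ) := by
    intro α hα
    by_cases hA : α ∈ A
    · refine ⟨0, Or.inl rfl, fun k => ?_⟩
      obtain ⟨t1, t2⟩ := traj α k
      obtain ⟨va, vb⟩ := valA α hA
      have : ε α = α := by simp [hε, hA]
      rw [this, t1, t2, va, vb]
      push_cast
      constructor
      · ring_nf
      · ring_nf
    · refine ⟨1, Or.inr rfl, fun k => ?_⟩
      obtain ⟨t1, t2⟩ := traj (-α) k
      obtain ⟨va, vb⟩ := valB α ((hFAB α hα).resolve_left hA)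
      have : ε α = -α := by simp [hε, hA]
      rw [this, t1, t2, va, vb]
      push_cast
      constructor
      · ring_nf
      · ring_nf
  have inj : ∀ α ∈ F, ∀ α' ∈ F, ∀ d : ℕ, d < K → (c ^ d) (ε α) = ε α' → d = 0 := by
    intro α hα α' hα' d hd he
    obtain ⟨i, hi, t⟩ := traj2 α hα
    obtain ⟨i', hi', t'⟩ := traj2 α' hα'
    obtain ⟨u1, u2⟩ := t d
    obtain ⟨v1, v2⟩ := t' 0
    rw [pow_zero, LinearIsometryEquiv.coe_one, id] at v1 v2
    rw [he] at u1 u2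
    have w1 := hW α hα
    have w2 := hW α' hα'
    have d0 : (d : ℤ) < K := by exact_mod_cast hd
    have d1 : 0 ≤ (d : ℤ) := by positivity
    rw [u1] at v1
    rw [u2] at v2
    rcases hi' with rfl | rfl
    · have a1 : Real.sin (((2 * d - i : ℤ) : ℝ) * θ) = 0 := by
        simp at v1
        rcases v1 with h | h
        · linarith
        · push_cast; exact h
      have a2 : 0 < Real.sin ((((2 * d - i : ℤ) : ℝ) + 1) * θ) := by
        have : 0 < W α * Real.sin (((2 * d + 1 - i : ℤ) : ℝ) * θ) := by
          rw [v2]; simp; positivity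
        have := (mul_pos_iff_of_pos_left w1).1 this
        have e : (((2 * d - i : ℤ) : ℝ) + 1) * θ = ((2 * d + 1 - i : ℤ) : ℝ) * θ := by
          push_cast; ring
        rw [e]; exact this
      have := trig_zero hK hsin _ a1 (Or.inl a2) (by omega) (by omega)
      omega
    · have a1 : Real.sin (((2 * d + 1 - i : ℤ) : ℝ) * θ) = 0 := by
        simp at v2
        rcases v2 with h | h
        · linarith
        · push_cast; exact h
      have a2 : Real.sin ((((2 * d + 1 - i : ℤ) : ℝ) - 1) * θ) < 0 := by
        have : W α * Real.sin (((2 * d - i : ℤ) : ℝ) * θ) < 0 := by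
          rw [v1]; simp; positivity
        have := neg_of_mul_neg_right this w1.le
        have e : (((2 * d + 1 - i : ℤ) : ℝ) - 1) * θ = ((2 * d - i : ℤ) : ℝ) * θ := by
          push_cast; ring
        rw [e]; exact this
      have := trig_zero hK hsin _ a1 (Or.inr a2) (by omega) (by omega)
      omega
  have hord : orderOf c = K := by
    rw [orderOf_eq_iff hKpos]
    refine ⟨hcK, fun m hm hm0 h => ?_⟩
    obtain ⟨a, ha⟩ := hAne
    have := inj a (hAF ha) a (hAF ha) m hm (by rw [h]; rfl)
    omega
  have exist : ∀ γ ∈ Δ, ∃ k : ℕ, ∃ α ∈ F, (c ^ k) γ = ε α := by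
    intro γ hγ
    set U : ℕ → ℝ := fun j => (g γ * Real.sin (j * θ) - f γ * Real.sin (j * θ - θ)) / Real.sin θ
      with hU
    have Uf : ∀ k : ℕ, U (2 * k) = f ((c ^ k) γ) := by
      intro k
      simp only [hU]
      rw [div_eq_iff hsin.ne', (traj γ k).1]; push_cast; rfl
    have Ug : ∀ k : ℕ, U (2 * k + 1) = g ((c ^ k) γ) := by
      intro k
      simp only [hU]
      rw [div_eq_iff hsin.ne', (traj γ k).2]; push_cast
      rw [add_mul, one_mul, add_sub_cancel_right]
    have UK : ∀ j, U (j + K) = - U j := by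
      intro j
      simp only [hU]
      push_cast
      rw [add_mul, hK, Real.sin_add_pi, add_sub_right_comm, Real.sin_add_pi]
      ring
    have Uf2 : ∀ k : ℕ, U (2 * k + 1 + 1) = f (sB ((c ^ k) γ)) := by
      intro k
      have : 2 * k + 1 + 1 = 2 * (k + 1) := by ring
      rw [this, Uf, pow_succ', liMul, hc, liMul, h1]
    have Unz : ∀ j, U j = 0 → U (j + 1) = 0 → False := by
      intro j hj hj1
      rcases Nat.even_or_odd' j with ⟨k, rfl | rfl⟩
      · rw [Uf] at hj; rw [Ug] at hj1
        rcases sgn _ (hcm k γ hγ) with h | h <;> linarith [h.2.2]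
      · rw [Ug] at hj; rw [Uf2] at hj1
        have := h4 ((c ^ k) γ)
        rcases sgn _ (hsB _ (hcm k γ hγ)) with h | h <;> linarith [h.2.2]
    obtain ⟨j, hj, hj1⟩ : ∃ j, U j ≤ 0 ∧ 0 < U (j + 1) := by
      by_contra hcon
      push Not at hcon
      have hall : ∀ j, U j ≤ 0 → ∀ n, U (j + n) ≤ 0 := by
        intro j hj n
        induction n with
        | zero => exact hj
        | succ n ih => exact hcon _ ih
      obtain ⟨j, hj⟩ : ∃ j, U j ≤ 0 := by
        by_contra hh
        push Not at hh
        have := hh 0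
        have := hh (0 + K)
        rw [UK] at this
        linarith
      have a1 := hall j hj K
      rw [UK] at a1
      have b0 := hall j hj 1
      have b1 := hall (j + 1) b0 K
      rw [UK] at b1
      exact Unz j (by linarith) (by linarith)
    rcases Nat.even_or_odd' j with ⟨k, rfl | rfl⟩
    · rw [Uf] at hj; rw [Ug] at hj1
      have hm : (c ^ k) γ ∈ A := by
        rw [hf] at hj; rw [hg] at hj1
        exact R.trans_mem hAF hBF (fun a ha h => (hFAB a ha).resolve_left h) hAo W hW
          (hcm k γ hγ) hj hj1
      exact ⟨k, _, hAF hm, by simp [hε, hm]⟩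
    · rw [Ug] at hj; rw [Uf2] at hj1
      rw [← h4] at hj
      have hm : sB ((c ^ k) γ) ∈ B := by
        rw [hg] at hj; rw [hf] at hj1
        exact R.trans_mem hBF hAF (fun a ha h => (hFAB a ha).resolve_right h) hBo W hW
          (hsB _ (hcm k γ hγ)) hj hj1
      have hnA : sB ((c ^ k) γ) ∉ A := fun h => hdis _ h hm
      refine ⟨k, _, hBF hm, ?_⟩
      simp only [hε, hnA, if_false]
      apply sB.injective
      rw [map_neg, hsBB _ hm, neg_neg]
  have εnorm : ∀ α, ‖ε α‖ = ‖α‖ := by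
    intro α
    simp only [hε]
    split_ifs <;> simp
  have εinj : ∀ α ∈ F, ∀ α' ∈ F, ε α = ε α' → α = α' := by
    have aux : ∀ α ∈ F, ∀ α' ∈ F, α ≠ -α' := by
      intro α hα α' hα' h
      have h5 := R.same α hα
      rw [h, map_neg] at h5
      have := R.pos_simple hα' α hα
      rw [h] at this
      linarith
    intro α hα α' hα' h
    simp only [hε] at h
    split_ifs at h with p q q
    · exact h
    · exact absurd h (aux _ hα _ hα')
    · exact absurd h.symm (aux _ hα' _ hα)
    · exact neg_injective h
  rw [hord]
  have himg : {α ∈ Δ | ‖α‖ = l} = (fun p : ℕ × E => (c ^ p.1) (ε p.2)) ''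
      (((Finset.range K) ×ˢ (F.filter fun α => ‖α‖ = l) : Finset (ℕ × E)) : Set (ℕ × E)) := by
    ext γ
    simp only [Set.mem_ofPred_eq, Set.mem_image, Finset.mem_coe, Finset.mem_product,
      Finset.mem_range, Finset.mem_filter, Prod.exists]
    constructor
    · rintro ⟨hγ, hn⟩
      obtain ⟨k, α, hα, e⟩ := exist γ hγ
      refine ⟨(k * (K - 1)) % K, α, ⟨Nat.mod_lt _ hKpos, hα, ?_⟩, ?_⟩
      · rw [← εnorm, ← e, LinearIsometryEquiv.norm_map, hn]
      · rw [← hord, pow_mod_orderOf, hord, ← e, ← liMul, ← pow_add]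
        have : k * (K - 1) + k = K * k := by
          obtain ⟨m, rfl⟩ : ∃ m, K = m + 1 := ⟨K - 1, by omega⟩
          simp; ring
        rw [this, pow_mul, hcK, one_pow]; rfl
    · rintro ⟨k, α, ⟨hk, hα, hn⟩, rfl⟩
      exact ⟨hcm k _ (εmem α hα), by rw [LinearIsometryEquiv.norm_map, εnorm, hn]⟩
  have hinjOn : Set.InjOn (fun p : ℕ × E => (c ^ p.1) (ε p.2))
      (((Finset.range K) ×ˢ (F.filter fun α => ‖α‖ = l) : Finset (ℕ × E)) : Set (ℕ × E)) := by
    have aux : ∀ k α k' α', k < K → k' < K → α ∈ F → α' ∈ F → k ≤ k' →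
        (c ^ k) (ε α) = (c ^ k') (ε α') → k = k' ∧ α = α' := by
      intro k α k' α' hk hk' hα hα' hkk he
      obtain ⟨d, rfl⟩ := Nat.exists_eq_add_of_le hkk
      rw [pow_add, liMul] at he
      have he' := (c ^ k).injective he
      have := inj α' hα' α hα d (by omega) he'.symm
      subst this
      exact ⟨rfl, εinj _ hα _ hα' he'⟩
    rintro ⟨k, α⟩ hp ⟨k', α'⟩ hp' he
    simp only [Finset.mem_coe, Finset.mem_product, Finset.mem_range, Finset.mem_filter] at hp hp' he
    rcases le_total k k' with h | h
    · obtain ⟨rfl, rfl⟩ := aux k α k' α' hp.1 hp'.1 hp.2.1 hp'.2.1 h he; rfl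
    · obtain ⟨rfl, rfl⟩ := aux k' α' k α hp'.1 hp.1 hp'.2.1 hp.2.1 h he.symm; rfl
  rw [himg, hinjOn.ncard_image, Set.ncard_coe_finset, Finset.card_product,
    Finset.card_range]
  congr 1
  rw [← Set.ncard_coe_finset]
  congr 1
  ext; simp

end RS
end aux4

section aux5
open Finset
variable {E : Type} [NormedAddCommGroup E] [InnerProductSpace ℝ E] [FiniteDimensional ℝ E]

lemma orth_mem {A : List E} (hA : A.Pairwise (fun a b => ⟪a, b⟫ = 0)) {a b : E} (ha : a ∈ A)
    (hb : b ∈ A) (h : a ≠ b) : ⟪a, b⟫ = 0 := by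
  haveI : Std.Symm (fun a b : E => ⟪a, b⟫ = 0) :=
    ⟨fun x y h => by rw [real_inner_comm]; exact h⟩
  exact hA.forall ha hb h

lemma half [DecidableEq E] {A : List E} (hn : A.Nodup) (hA : A.Pairwise (fun a b => ⟪a, b⟫ = 0))
    (h0 : ∀ a ∈ A, a ≠ 0) (w : E → ℝ) (s : ℝ) (p q : E)
    (hp : ∀ a ∈ A, ⟪a, p⟫ = s * (w a * ⟪a, a⟫)) (hq : ∀ a ∈ A, ⟪a, q⟫ = 0) (z : E) :
    ⟪(A.map rrefl).prod z, q⟫ = ⟪z, q⟫ ∧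
    ⟪(A.map rrefl).prod z, p⟫ = ⟪z, p⟫ - 2 * s * ⟪z, ∑ a ∈ A.toFinset, w a • a⟫ := by
  rw [prod_orth z A hn hA]
  simp only [inner_sub_left, sum_inner, inner_sum, real_inner_smul_left, real_inner_smul_right]
  constructor
  · rw [Finset.sum_eq_zero, sub_zero]
    intro a ha
    rw [hq a (by simpa using ha), mul_zero]
  · congr 1
    rw [Finset.mul_sum]
    apply Finset.sum_congr rfl
    intro a ha
    have ha' : a ∈ A := by simpa using ha
    have : ⟪a, a⟫ ≠ 0 := inner_self_ne_zero.2 (h0 a ha')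
    rw [hp a ha', real_inner_comm z a]
    field_simp

lemma prod_neg [DecidableEq E] {A : List E} (hn : A.Nodup)
    (hA : A.Pairwise (fun a b => ⟪a, b⟫ = 0)) (h0 : ∀ a ∈ A, a ≠ 0) (b : E) (hb : b ∈ A) :
    (A.map rrefl).prod b = -b := by
  rw [prod_orth b A hn hA, Finset.sum_eq_single_of_mem b (by simpa using hb)]
  · have : ⟪b, b⟫ ≠ 0 := inner_self_ne_zero.2 (h0 b hb)
    rw [mul_div_assoc, div_self this]; module
  · intro a ha hne
    rw [orth_mem hA (by simpa using ha) hb hne]; simp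

namespace RS
variable {Δ : Set E} {F : Finset E} {co : E → E →ₗ[ℝ] ℝ}

lemma prod_mem (R : RS Δ F co) : ∀ (N : List E), (∀ a ∈ N, a ∈ F) → ∀ γ ∈ Δ,
    (N.map rrefl).prod γ ∈ Δ := by
  intro N
  induction N with
  | nil => intro _ γ h; simpa using h
  | cons b N ih =>
    intro hN γ h
    rw [List.map_cons, List.prod_cons, liMul]
    exact R.refl _ (R.sub _ (hN b List.mem_cons_self)) _
      (ih (fun a ha => hN a (List.mem_cons_of_mem _ ha)) γ h)

lemma eig [DecidableEq E] {A B : Finset E} {w : E → ℝ} {κ : ℝ}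
    (ho : ∀ a ∈ A, ∀ b ∈ A, a ≠ b → ⟪a, b⟫ = 0) {a : E} (ha : a ∈ A)
    (h : ⟪a, ∑ β ∈ A, w β • β + ∑ β ∈ B, w β • β⟫ = κ * (w a * ⟪a, a⟫)) :
    ⟪a, ∑ β ∈ A, w β • β⟫ = w a * ⟪a, a⟫ ∧
    ⟪a, ∑ β ∈ B, w β • β⟫ = - (1 - κ) * (w a * ⟪a, a⟫) := by
  have h1 : ⟪a, ∑ β ∈ A, w β • β⟫ = w a * ⟪a, a⟫ := by
    rw [inner_sum, Finset.sum_eq_single_of_mem a ha, real_inner_smul_right]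
    intro b hb hne
    rw [real_inner_smul_right, ho a ha b hb hne.symm, mul_zero]
  refine ⟨h1, ?_⟩
  rw [inner_add_right, h1] at h
  linarith

lemma final (R : RS Δ F co) (lΦ : List E) (hnd : lΦ.Nodup) (hl : ∀ a, a ∈ lΦ ↔ a ∈ F)
    (hlen : ∃ γ ∈ Δ, ∃ δ ∈ Δ, ‖γ‖ ≠ ‖δ‖) (l : ℝ) :
    {α ∈ Δ | ‖α‖ = l}.ncard = orderOf (lΦ.map rrefl).prod * {α | α ∈ F ∧ ‖α‖ = l}.ncard := by
  classical
  obtain ⟨A, B, hA, hB, hm⟩ := R.bipart _ lΦ rfl hnd (fun a ha => (hl a).1 ha)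
  have hndAB := hm.perm.nodup_iff.1 hnd
  obtain ⟨hnA, hnB, hdis⟩ := List.nodup_append.1 hndAB
  have hFmem : ∀ a, a ∈ F ↔ a ∈ A ∨ a ∈ B := by
    intro a; rw [← hl, hm.perm.mem_iff, List.mem_append]
  have hAF : ∀ a ∈ A, a ∈ F := fun a ha => (hFmem a).2 (Or.inl ha)
  have hBF : ∀ a ∈ B, a ∈ F := fun a ha => (hFmem a).2 (Or.inr ha)
  have hA0 : ∀ a ∈ A, a ≠ 0 := fun a ha => R.ne0 (R.sub _ (hAF a ha))
  have hB0 : ∀ a ∈ B, a ≠ 0 := fun a ha => R.ne0 (R.sub _ (hBF a ha))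
  have hFne : F.Nonempty := by
    rw [Finset.nonempty_iff_ne_empty]
    intro h
    obtain ⟨γ, hγ, _⟩ := hlen
    apply R.ne0 hγ
    apply R.ext0
    rw [h]; simp
  -- not all simple roots are orthogonal
  have hnorth : ¬ ∀ a ∈ F, ∀ b ∈ F, a ≠ b → ⟪a, b⟫ = 0 := by
    intro h
    obtain ⟨α, hα⟩ := hFne
    have key : ∀ γ ∈ Δ, ‖γ‖ = ‖α‖ := by
      intro γ hγ
      have hall : ∀ β ∈ F, β = α := by
        rcases R.part (fun β => β = α) (by
          rintro a ha b hb rfl hb'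
          exact h _ ha b hb (Ne.symm hb')) with h' | h'
        · exact h'
        · exact absurd rfl (h' α hα)
      have e : γ = co α γ • α := by
        conv_lhs => rw [← R.dec γ]
        exact Finset.sum_eq_single_of_mem α hα fun β hβ hne => absurd (hall β hβ) hne
      rcases R.red α (R.sub _ hα) (co α γ) (e ▸ hγ) with h1 | h1
      · rw [e, h1, one_smul]
      · rw [e, h1, neg_one_smul, norm_neg]
    obtain ⟨γ, hγ, δ, hδ, hne⟩ := hlen
    exact hne ((key γ hγ).trans (key δ hδ).symm)
  obtain ⟨a₀, ha₀, b₀, hb₀, hab₀⟩ : ∃ a ∈ A, ∃ b ∈ B, ⟪a, b⟫ ≠ 0 := by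
    by_contra hc
    push Not at hc
    apply hnorth
    rcases R.part (fun a => a ∈ A) (fun a ha b hb h1 h2 =>
      hc a h1 b (((hFmem b).1 hb).resolve_left h2)) with h' | h'
    · exact fun a ha b hb hne => orth_mem hA (h' a ha) (h' b hb) hne
    · exact fun a ha b hb hne => orth_mem hB (((hFmem a).1 ha).resolve_left (h' a ha))
        (((hFmem b).1 hb).resolve_left (h' b hb)) hne
  obtain ⟨w, κ, hw, hκ, hpf⟩ := R.pf hFne
  have hFu : F = A.toFinset ∪ B.toFinset := by
    ext a; simp [hFmem]
  have hdj : Disjoint A.toFinset B.toFinset := by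
    rw [Finset.disjoint_left]
    intro a ha hb
    exact hdis a (by simpa using ha) a (by simpa using hb) rfl
  set x := ∑ β ∈ A.toFinset, w β • β with hx
  set y := ∑ β ∈ B.toFinset, w β • β with hy
  have hxy : ∑ β ∈ F, w β • β = x + y := by
    rw [hFu, Finset.sum_union hdj]
  rw [hxy] at hpf
  set μ := 1 - κ with hμ
  have oA : ∀ a ∈ A.toFinset, ∀ b ∈ A.toFinset, a ≠ b → ⟪a, b⟫ = 0 := fun a ha b hb h =>
    orth_mem hA (by simpa using ha) (by simpa using hb) h
  have oB : ∀ a ∈ B.toFinset, ∀ b ∈ B.toFinset, a ≠ b → ⟪a, b⟫ = 0 := fun a ha b hb h =>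
    orth_mem hB (by simpa using ha) (by simpa using hb) h
  have eA : ∀ a ∈ A, ⟪a, x⟫ = w a * ⟪a, a⟫ ∧ ⟪a, y⟫ = - μ * (w a * ⟪a, a⟫) := fun a ha =>
    eig oA (by simpa using ha) (hpf a (hAF a ha))
  have eB : ∀ b ∈ B, ⟪b, y⟫ = w b * ⟪b, b⟫ ∧ ⟪b, x⟫ = - μ * (w b * ⟪b, b⟫) := fun b hb =>
    eig oB (by simpa using hb) (by rw [add_comm]; exact hpf b (hBF b hb))
  have hμ1 : μ < 1 := by linarith
  have hμ0 : 0 < μ := by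
    have h1 := (eA a₀ ha₀).2
    have h2 : ⟪a₀, y⟫ < 0 := by
      rw [hy, inner_sum]
      have hnp : ∀ b ∈ B.toFinset, ⟪a₀, b⟫ ≤ 0 := by
        intro b hb
        have hb' : b ∈ B := by simpa using hb
        exact R.nonpos (hAF _ ha₀) (hBF b hb') (fun h => hdis a₀ ha₀ b hb' h.symm)
      apply Finset.sum_neg'
      · intro b hb
        rw [real_inner_smul_right]
        exact mul_nonpos_of_nonneg_of_nonpos (hw b (hBF b (by simpa using hb))).le (hnp b hb)
      · refine ⟨b₀, by simpa using hb₀, ?_⟩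
        rw [real_inner_smul_right]
        exact mul_neg_of_pos_of_neg (hw b₀ (hBF b₀ hb₀))
          (lt_of_le_of_ne (hnp b₀ (by simpa using hb₀)) hab₀)
    have h3 := hw a₀ (hAF _ ha₀)
    have h4 := R.ipos (R.sub _ (hAF _ ha₀))
    have h5 : 0 < w a₀ * ⟪a₀, a₀⟫ := by positivity
    by_contra hc
    push Not at hc
    nlinarith
  set s := 1 - μ ^ 2 with hs
  have hs0 : 0 < s := by rw [hs]; nlinarith
  set p := x + μ • y with hp
  set q := y + μ • x with hq
  have pA : ∀ a ∈ A, ⟪a, p⟫ = s * (w a * ⟪a, a⟫) := by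
    intro a ha
    rw [hp, inner_add_right, real_inner_smul_right, (eA a ha).1, (eA a ha).2, hs]; ring
  have qA : ∀ a ∈ A, ⟪a, q⟫ = 0 := by
    intro a ha
    rw [hq, inner_add_right, real_inner_smul_right, (eA a ha).1, (eA a ha).2]; ring
  have qB : ∀ a ∈ B, ⟪a, q⟫ = s * (w a * ⟪a, a⟫) := by
    intro a ha
    rw [hq, inner_add_right, real_inner_smul_right, (eB a ha).1, (eB a ha).2, hs]; ring
  have pB : ∀ a ∈ B, ⟪a, p⟫ = 0 := by
    intro a ha
    rw [hp, inner_add_right, real_inner_smul_right, (eB a ha).1, (eB a ha).2]; ring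
  have expand : ∀ z r, ⟪z, r⟫ = ∑ β ∈ A.toFinset, co β z * ⟪β, r⟫ +
      ∑ β ∈ B.toFinset, co β z * ⟪β, r⟫ := by
    intro z r
    rw [← Finset.sum_union hdj, ← hFu]
    conv_lhs => rw [← R.dec z]
    simp only [sum_inner, real_inner_smul_left]
  have hord : orderOf (lΦ.map rrefl).prod =
      orderOf ((A.map rrefl).prod * (B.map rrefl).prod) := by
    rw [← List.prod_append, ← List.map_append]
    obtain ⟨u, hu⟩ := hm.conj
    exact hu.orderOf_eq
  rw [hord]
  refine R.count A.toFinset B.toFinset (fun a ha => hAF a (by simpa using ha))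
    (fun a ha => hBF a (by simpa using ha)) (fun a ha => by simpa using (hFmem a).1 ha)
    (fun a ha => Finset.disjoint_left.1 hdj ha) ⟨a₀, by simpa using ha₀⟩ oA oB
    _ _ (R.prod_mem A hAF) (R.prod_mem B hBF)
    (fun b hb => prod_neg hnB hB hB0 b (by simpa using hb))
    (A ++ B) (fun a ha => (hFmem a).2 (by simpa using ha)) (by simp)
    (fun a => s * (w a * ⟪a, a⟫)) ?_ (fun z => ⟪z, q⟫) (fun z => ⟪z, p⟫) ?_ ?_ μ hμ0 hμ1
    ?_ ?_ ?_ ?_ l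
  · intro a ha
    have := R.ipos (R.sub _ ha)
    have := hw a ha
    positivity
  · intro z
    rw [expand z q, Finset.sum_eq_zero, zero_add]
    · exact Finset.sum_congr rfl fun b hb => by rw [qB b (by simpa using hb)]
    · intro a ha; rw [qA a (by simpa using ha), mul_zero]
  · intro z
    rw [expand z p, add_comm, Finset.sum_eq_zero, zero_add]
    · exact Finset.sum_congr rfl fun b hb => by rw [pA b (by simpa using hb)]
    · intro a ha; rw [pB a (by simpa using ha), mul_zero]
  · intro z; exact (half hnA hA hA0 w s p q pA qA z).1
  · intro z
    rw [(half hnA hA hA0 w s p q pA qA z).2, ← hx, hp, hq, hs]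
    simp only [inner_add_right, real_inner_smul_right]; ring
  · intro z
    rw [(half hnB hB hB0 w s q p qB pB z).2, ← hy, hp, hq, hs]
    simp only [inner_add_right, real_inner_smul_right]; ring
  · intro z; exact (half hnB hB hB0 w s q p qB pB z).1

end RS
end aux5

/-- The number of short roots equals the Coxeter number times the number of
short simple roots: `#Δs = h · #Πs`. -/
theorem statement2
    {E : Type} [NormedAddCommGroup E] [InnerProductSpace ℝ E] [FiniteDimensional ℝ E]
    (Δ Δs Δl Δp Φ Φs : Set E)
    -- `Δ` is a finite set of nonzero vectors spanning `E`
    (hfin : Δ.Finite) (h0 : (0 : E) ∉ Δ)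
    (hspan : Submodule.span ℝ Δ = ⊤)
    -- stable under all root reflections
    (hrefl : ∀ α ∈ Δ, ∀ β ∈ Δ, rrefl α β ∈ Δ)
    -- crystallographic
    (hcrys : ∀ α ∈ Δ, ∀ β ∈ Δ, ∃ n : ℤ, 2 * ⟪β, α⟫ / ⟪α, α⟫ = (n : ℝ))
    -- reduced
    (hred : ∀ α ∈ Δ, ∀ t : ℝ, t • α ∈ Δ → t = 1 ∨ t = -1)
    -- irreducible
    (hirr : ∀ A B : Set E, A ∪ B = Δ → (∀ a ∈ A, ∀ b ∈ B, ⟪a, b⟫ = 0) → A = ∅ ∨ B = ∅)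
    -- two root lengths: `Δs` are the short roots, `Δl` the long ones
    (ls ll : ℝ) (h0ls : 0 < ls) (hlsll : ls < ll)
    (hΔs : Δs = {α ∈ Δ | ‖α‖ = ls}) (hΔl : Δl = {α ∈ Δ | ‖α‖ = ll})
    (hcover : Δ = Δs ∪ Δl) (hsne : Δs.Nonempty) (hlne : Δl.Nonempty)
    -- `Δp` is a positive system: for each root exactly one of `±α` is positive
    (hΔpΔ : Δp ⊆ Δ) (hpm : ∀ α ∈ Δ, α ∈ Δp ↔ -α ∉ Δp)
    -- `Φ` is the corresponding set of simple roots, `Φs = Φ ∩ Δs` the short simple roots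
    (hΦp : Φ ⊆ Δp)
    (hΦind : LinearIndependent ℝ (fun a : Φ => (a : E)))
    (hΦdec : ∀ γ ∈ Δp, ∃ c : E →₀ ℕ, ↑c.support ⊆ Φ ∧ γ = c.sum fun α n => (n : ℝ) • α)
    (hΦs : Φs = Φ ∩ Δs)
    -- `h` is the Coxeter number: the order of a Coxeter element, i.e. of the product of
    -- all simple reflections (in some order)
    (lΦ : List E) (hlnd : lΦ.Nodup) (hlset : {x | x ∈ lΦ} = Φ)
    (h : ℕ) (hcox : h = orderOf ((lΦ.map rrefl).prod))
 :
    Δs.ncard = h * Φs.ncard := by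

  classical
  have hF : ∀ a, a ∈ lΦ.toFinset ↔ a ∈ Φ := by
    intro a; rw [List.mem_toFinset, ← hlset]; rfl
  have hdec' : ∀ γ ∈ Δp, γ ∈ Submodule.span ℝ Φ := by
    intro γ hγ
    obtain ⟨c, hc, e⟩ := hΦdec γ hγ
    rw [e]
    exact Submodule.sum_mem _ fun a ha => Submodule.smul_mem _ _ (Submodule.subset_span (hc ha))
  have hsp : ⊤ ≤ Submodule.span ℝ (Set.range (fun a : Φ => (a : E))) := by
    rw [Subtype.range_coe, ← hspan, Submodule.span_le]
    intro γ hγ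
    by_cases h1 : γ ∈ Δp
    · exact hdec' γ h1
    · have h2 : -γ ∈ Δp := by
        by_contra h3; exact h1 ((hpm γ hγ).2 h3)
      simpa using Submodule.neg_mem _ (hdec' _ h2)
  let b := Module.Basis.mk hΦind hsp
  let co : E → E →ₗ[ℝ] ℝ := fun β => if h : β ∈ Φ then b.coord ⟨β, h⟩ else 0
  have hb : ∀ i : Φ, b i = (i : E) := fun i => by simp [b]
  have hcoin : ∀ β (h : β ∈ Φ), co β = b.coord ⟨β, h⟩ := fun β h => by simp [co, h]
  have hsame : ∀ α ∈ Φ, co α α = 1 := by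
    intro α h
    rw [hcoin α h]
    have := hb ⟨α, h⟩
    have e2 : b.coord ⟨α, h⟩ (b ⟨α, h⟩) = 1 := by simp
    rw [this] at e2
    exact e2
  have hdiff : ∀ α ∈ Φ, ∀ β ∈ Φ, β ≠ α → co β α = 0 := by
    intro α hα β hβ hne
    rw [hcoin β hβ]
    have := hb ⟨α, hα⟩
    have e2 : b.coord ⟨β, hβ⟩ (b ⟨α, hα⟩) = 0 := by
      simp only [Module.Basis.coord_apply, Module.Basis.repr_self]
      rw [Finsupp.single_eq_of_ne]
      intro h
      exact hne (congrArg Subtype.val h)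
    rw [this] at e2
    exact e2
  have hpos : ∀ γ ∈ Δp, ∀ β ∈ Φ, 0 ≤ co β γ := by
    intro γ hγ β hβ
    obtain ⟨c, hc, e⟩ := hΦdec γ hγ
    rw [e, Finsupp.sum, map_sum]
    apply Finset.sum_nonneg
    intro a ha
    rw [map_smul]
    apply mul_nonneg (by positivity)
    by_cases h : β = a
    · subst h; rw [hsame β hβ]; norm_num
    · rw [hdiff a (hc ha) β hβ h]
  have hR : RS Δ lΦ.toFinset co := by
    refine ⟨hfin, h0, hrefl, hcrys, hred, hirr, fun α hα => hΔpΔ (hΦp ((hF α).1 hα)), ?_,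
      fun α hα => hsame α ((hF α).1 hα),
      fun α hα β hβ => hdiff α ((hF α).1 hα) β ((hF β).1 hβ), ?_⟩
    · intro z
      have : z ∈ Submodule.span ℝ (Set.range (fun a : Φ => (a : E))) := hsp trivial
      rw [Subtype.range_coe] at this
      induction this using Submodule.span_induction with
      | mem x hx =>
        rw [Finset.sum_eq_single_of_mem x ((hF x).2 hx), hsame x hx, one_smul]
        intro β hβ hne
        rw [hdiff x hx β ((hF β).1 hβ) hne, zero_smul]
      | zero => simp
      | add x y _ _ hx hy =>
        simp only [map_add, add_smul, Finset.sum_add_distrib]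
        rw [hx, hy]
      | smul t x _ hx =>
        simp only [map_smul, smul_eq_mul, mul_smul, ← Finset.smul_sum]
        rw [hx]
    · intro γ hγ
      by_cases h1 : γ ∈ Δp
      · left; exact fun β hβ => hpos γ h1 β ((hF β).1 hβ)
      · right
        have h2 : -γ ∈ Δp := by
          by_contra h3; exact h1 ((hpm γ hγ).2 h3)
        intro β hβ
        have := hpos _ h2 β ((hF β).1 hβ)
        rw [map_neg] at this
        linarith
  have key := hR.final lΦ hlnd (fun a => by simp) (by
    obtain ⟨γ, hγ⟩ := hsne
    obtain ⟨δ, hδ⟩ := hlne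
    rw [hΔs] at hγ
    rw [hΔl] at hδ
    exact ⟨γ, hγ.1, δ, hδ.1, by rw [hγ.2, hδ.2]; exact hlsll.ne⟩) ls
  have e : Φs = {α | α ∈ lΦ.toFinset ∧ ‖α‖ = ls} := by
    rw [hΦs, hΔs]
    ext α
    constructor
    · rintro ⟨h1, h2⟩; exact ⟨(hF α).2 h1, h2.2⟩
    · rintro ⟨h1, h2⟩
      exact ⟨(hF α).1 h1, hΔpΔ (hΦp ((hF α).1 h1)), h2⟩
  rw [hcox, e, hΔs]
  exact key
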